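/- Every finite semigroup S divides an iterated wreath product X₁ ≀ (X₂ ≀ (⋯ ≀ Xₙ)) in which each factor Xᵢ is either the three-element flip-flop monoid U or a finite simple group that divides S. (Krohn–Rhodes prime decomposition theorem.) -/

import Mathlib

/-- The wreath product `M ≀ N` of monoids: underlying set `(N → M) × N` with
multiplication `(f, n)(g, n') = (x ↦ f x · g (x·n), n·n')`. -/
def Wreath (M N : Type) [Monoid M] [Monoid N] : Type := (N → M) × N

instance {M N : Type} [Monoid M] [Monoid N] : Monoid (Wreath M N) where
  mul a b := (fun x => a.1 x * b.1 (x * a.2), a.2 * b.2)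
  one := (fun _ => 1, 1)
  mul_assoc a b c := by
    show (Prod.mk _ _ : (N → M) × N) = Prod.mk _ _
    refine Prod.ext ?_ ?_
    · funext x
      show (a.1 x * b.1 (x * a.2)) * c.1 (x * (a.2 * b.2)) =
        a.1 x * (b.1 (x * a.2) * c.1 ((x * a.2) * b.2))
      rw [mul_assoc, mul_assoc]
    · exact mul_assoc a.2 b.2 c.2
  one_mul a := by
    refine Prod.ext ?_ ?_
    · funext x
      show 1 * a.1 (x * 1) = a.1 x
      rw [one_mul, mul_one]
    · exact one_mul a.2
  mul_one a := by
    refine Prod.ext ?_ ?_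
    · funext x
      show a.1 x * 1 = a.1 x
      exact mul_one _
    · exact mul_one a.2

/-- The three-element flip-flop monoid `U = {1, a, b}`, with identity `1` and
`a, b` right zeros. -/
inductive FlipFlop : Type
  | one : FlipFlop
  | a : FlipFlop
  | b : FlipFlop
deriving DecidableEq

instance : Monoid FlipFlop where
  mul x y := match y with
    | .one => x
    | .a => .a
    | .b => .b
  one := .one
  mul_assoc x y z := by cases z <;> cases y <;> rfl
  one_mul x := by cases x <;> rfl
  mul_one x := rfl

/-- The iterated wreath product `X₁ ≀ (X₂ ≀ (⋯ ≀ Xₙ))` of a list of (bundled)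
monoids; the empty product is the trivial monoid. -/
def iterWreath : List MonCat → MonCat
  | [] => MonCat.of PUnit
  | M :: Ms => MonCat.of (Wreath M (iterWreath Ms))

/-- A semigroup `S` divides a semigroup `T` if `S` is a homomorphic image of a
subsemigroup of `T`. -/
def Divides (S T : Type) [Mul S] [Mul T] : Prop :=
  ∃ (U : Subsemigroup T) (f : U →ₙ* S), Function.Surjective f

/-! ### Simulation of transformation sets -/

/-- `(X, T)` is simulated by `(Y, Q)`. -/
def Sim {X Y : Type} (T : Set (X → X)) (Q : Set (Y → Y)) : Prop :=
  ∃ p : Y → X, Function.Surjective p ∧ ∀ t ∈ T, ∃ q ∈ Q, ∀ y, p (q y) = t (p y)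

theorem Sim.trans {X Y Z : Type} {T : Set (X → X)} {Q : Set (Y → Y)} {R : Set (Z → Z)}
    (h : Sim T Q) (k : Sim Q R) : Sim T R := by
  obtain ⟨p, hp, h⟩ := h
  obtain ⟨r, hr, k⟩ := k
  refine ⟨p ∘ r, hp.comp hr, fun t ht => ?_⟩
  obtain ⟨q, hq, hq'⟩ := h t ht
  obtain ⟨s, hs, hs'⟩ := k q hq
  exact ⟨s, hs, fun y => by simp [hs', hq']⟩

theorem Sim.mono {X : Type} {T Q : Set (X → X)} (h : T ⊆ Q) : Sim T Q :=
  ⟨id, Function.surjective_id, fun t ht => ⟨t, h ht, fun _ => rfl⟩⟩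

/-- Cascade of transformation sets. -/
def casc {X Y : Type} (T : Set (X → X)) (Q : Set (Y → Y)) : Set (X × Y → X × Y) :=
  {g | ∃ (t : Y → X → X) (q : Y → Y), (∀ y, t y ∈ T) ∧ q ∈ Q ∧ g = fun z => (t z.2 z.1, q z.2)}

theorem Sim.casc {X Y X' Y' : Type} {T : Set (X → X)} {Q : Set (Y → Y)}
    {T' : Set (X' → X')} {Q' : Set (Y' → Y')} (h : Sim T T') (k : Sim Q Q') :
    Sim (casc T Q) (casc T' Q') := by
  obtain ⟨p, hp, h⟩ := h
  obtain ⟨r, hr, k⟩ := k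
  refine ⟨Prod.map p r, hp.prodMap hr, ?_⟩
  rintro _ ⟨t, q, ht, hq, rfl⟩
  obtain ⟨q', hq', e⟩ := k q hq
  choose t' ht' ee using fun y => h (t y) (ht y)
  exact ⟨_, ⟨fun y' => t' (r y'), q', fun y => ht' _, hq', rfl⟩, fun y => by simp [e, ee]⟩

/-- Right multiplications. -/
def rm (M : Type) [Monoid M] : Set (M → M) := {t | ∃ m, t = fun x => x * m}

/-- All constant maps. -/
def cst (X : Type) : Set (X → X) := {t | ∃ m, t = fun _ => m}

/-- Storage: identity and constants. -/
def stor (X : Type) : Set (X → X) := {id} ∪ cst X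

/-- Right multiplications and constants. -/
def rmc (M : Type) [Monoid M] : Set (M → M) := rm M ∪ cst M

theorem stor_sim {X Y : Type} (p : Y → X) (hp : Function.Surjective p) :
    Sim (stor X) (stor Y) := by
  refine ⟨p, hp, ?_⟩
  rintro t (rfl | ⟨m, rfl⟩)
  · exact ⟨id, Or.inl rfl, fun _ => rfl⟩
  · obtain ⟨y, rfl⟩ := hp m
    exact ⟨fun _ => y, Or.inr ⟨y, rfl⟩, fun _ => rfl⟩

theorem rm_equiv {M N : Type} [Monoid M] [Monoid N] (e : N ≃* M) : Sim (rm M) (rm N) := by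
  refine ⟨e, e.surjective, ?_⟩
  rintro _ ⟨m, rfl⟩
  exact ⟨_, ⟨e.symm m, rfl⟩, fun y => by simp⟩

/-- Closed under identity and composition. -/
def IsCl {X : Type} (T : Set (X → X)) : Prop := id ∈ T ∧ ∀ f ∈ T, ∀ g ∈ T, g ∘ f ∈ T

theorem stor_cl (X : Type) : IsCl (stor X) := by
  refine ⟨Or.inl rfl, ?_⟩
  rintro f hf g (rfl | ⟨m, rfl⟩)
  · exact hf
  · exact Or.inr ⟨m, rfl⟩

theorem rmc_cl (M : Type) [Monoid M] : IsCl (rmc M) := by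
  refine ⟨Or.inl ⟨1, by funext x; simp⟩, ?_⟩
  rintro f (⟨n, rfl⟩ | ⟨n, rfl⟩) g (⟨m, rfl⟩ | ⟨m, rfl⟩)
  · exact Or.inl ⟨n * m, by funext x; simp [mul_assoc]⟩
  · exact Or.inr ⟨m, rfl⟩
  · exact Or.inr ⟨n * m, rfl⟩
  · exact Or.inr ⟨m, rfl⟩

theorem casc_cl {X Y : Type} {T : Set (X → X)} {Q : Set (Y → Y)} (hT : IsCl T) (hQ : IsCl Q) :
    IsCl (casc T Q) := by
  refine ⟨⟨fun _ => id, id, fun _ => hT.1, hQ.1, rfl⟩, ?_⟩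
  rintro _ ⟨t, q, ht, hq, rfl⟩ _ ⟨t', q', ht', hq', rfl⟩
  exact ⟨fun y => t' (q y) ∘ t y, q' ∘ q, fun y => hT.2 _ (ht _) _ (ht' _), hQ.2 _ hq _ hq', rfl⟩

theorem casc_cst {X Y : Type} {T : Set (X → X)} {Q : Set (Y → Y)} (hT : cst X ⊆ T)
    (hQ : cst Y ⊆ Q) : cst (X × Y) ⊆ casc T Q := by
  rintro _ ⟨⟨x, y⟩, rfl⟩
  exact ⟨fun _ _ => x, fun _ => y, fun _ => hT ⟨x, rfl⟩, hQ ⟨y, rfl⟩, rfl⟩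

/-- State set of a list of factors. -/
def St : List MonCat.{0} → Type
  | [] => PUnit
  | M :: Ms => M × St Ms

/-- Cascade transformations of a list of factors. -/
def Tr : (L : List MonCat.{0}) → Set (St L → St L)
  | [] => {id}
  | M :: Ms => casc (rm M) (Tr Ms)

theorem Tr_append (L₁ L₂ : List MonCat.{0}) : Sim (casc (Tr L₁) (Tr L₂)) (Tr (L₁ ++ L₂)) := by
  induction L₁ with
  | nil =>
    refine ⟨fun y => (PUnit.unit, y), fun y => ⟨y.2, rfl⟩, ?_⟩
    rintro _ ⟨t, q, ht, hq, rfl⟩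
    exact ⟨q, hq, fun y => rfl⟩
  | cons A L ih =>
    have h2 : Sim (casc (rm A) (casc (Tr L) (Tr L₂))) (Tr ((A :: L) ++ L₂)) :=
      Sim.casc (Sim.mono (le_refl _)) ih
    refine Sim.trans ?_ h2
    refine ⟨fun z => ((z.1, z.2.1), z.2.2), fun z => ⟨(z.1.1, z.1.2, z.2), rfl⟩, ?_⟩
    rintro _ ⟨t, q, ht, hq, rfl⟩
    choose f g hf hg e using ht
    refine ⟨_, ⟨fun z => f z.2 z.1, fun z => (g z.2 z.1, q z.2), fun z => hf _ _,
      ⟨g, q, hg, hq, rfl⟩, rfl⟩, ?_⟩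
    rintro ⟨a, l, l2⟩
    simp [e]

theorem Tr_wreath (L : List MonCat.{0}) : Sim (Tr L) (rm (iterWreath L)) := by
  induction L with
  | nil =>
    refine ⟨fun y => y, fun y => ⟨y, rfl⟩, ?_⟩
    rintro _ rfl
    exact ⟨_, ⟨1, rfl⟩, fun y => rfl⟩
  | cons A L ih =>
    obtain ⟨p, hp, h⟩ := ih
    let p' : (iterWreath L → A) × iterWreath L → A × St L := fun w => (w.1 1, p w.2)
    refine ⟨p', ?_, ?_⟩
    · rintro ⟨a, l⟩
      obtain ⟨w, rfl⟩ := hp l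
      exact ⟨(fun _ => a, w), rfl⟩
    · rintro _ ⟨t, q, ht, hq, rfl⟩
      obtain ⟨_, ⟨v, rfl⟩, hv⟩ := h q hq
      choose f hf using ht
      let W : Wreath A (iterWreath L) := (fun w => f (p w), v)
      refine ⟨_, ⟨W, rfl⟩, ?_⟩
      rintro ⟨g, w⟩
      refine Prod.ext ?_ ?_
      · show g 1 * f (p (1 * w)) = t (p w) (g 1)
        rw [hf, one_mul]
      · exact hv w

theorem Sim.divides {M W : Type} [Monoid M] [Monoid W] (h : Sim (rm M) (rm W)) :
    Divides M W := by
  obtain ⟨p, hp, h⟩ := h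
  let V : Subsemigroup W :=
    { carrier := {w | ∃ m, ∀ y, p (y * w) = p y * m}
      mul_mem' := by
        rintro a b ⟨m, hm⟩ ⟨n, hn⟩
        exact ⟨m * n, fun y => by rw [← mul_assoc, hn, hm, mul_assoc]⟩ }
  have key : ∀ w : V, ∃ m, ∀ y, p (y * w.1) = p y * m := fun w => w.2
  choose f hf using key
  obtain ⟨y₁, hy₁⟩ := hp 1
  have uniq : ∀ (w : V) m, p (y₁ * w.1) = p y₁ * m → f w = m := by
    intro w m h
    rw [hf, hy₁, one_mul, one_mul] at h
    exact h
  refine ⟨V, ⟨f, ?_⟩, ?_⟩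
  · intro a b
    apply uniq
    show p (y₁ * (a.1 * b.1)) = _
    rw [← mul_assoc, hf, hf, mul_assoc]
  · intro m
    obtain ⟨_, ⟨w, rfl⟩, hw⟩ := h _ ⟨m, rfl⟩
    exact ⟨⟨w, m, hw⟩, uniq _ _ (hw _)⟩

theorem Divides.trans' {A B C : Type} [Mul A] [Mul B] [Mul C] (h : Divides A B)
    (k : Divides B C) : Divides A C := by
  obtain ⟨U, f, hf⟩ := h
  obtain ⟨V, g, hg⟩ := k
  let W : Subsemigroup C := (U.comap g).map (MulMemClass.subtype V)
  have hW : ∀ w : W, ∃ v : V, g v ∈ U ∧ v.1 = w.1 := by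
    rintro ⟨w, v, hv, e⟩
    exact ⟨v, hv, e⟩
  choose v hv e using hW
  refine ⟨W, ⟨fun w => f ⟨g (v w), hv w⟩, ?_⟩, ?_⟩
  · intro a b
    rw [← map_mul]
    congr 1
    apply Subtype.ext
    show g (v (a * b)) = g (v a) * g (v b)
    rw [← map_mul]
    congr 1
    apply Subtype.ext
    rw [e]
    show a.1 * b.1 = (v a).1 * (v b).1
    rw [e, e]
  · intro a
    obtain ⟨⟨b, hb⟩, rfl⟩ := hf a
    obtain ⟨c, rfl⟩ := hg b
    refine ⟨⟨c.1, c, hb, rfl⟩, ?_⟩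
    show f _ = f _
    congr 2
    apply congrArg g
    exact Subtype.ext (e _)

theorem divides_of_surj {A B : Type} [Mul A] [Mul B] (f : B →ₙ* A)
    (hf : Function.Surjective f) : Divides A B :=
  ⟨⊤, f.comp (MulMemClass.subtype ⊤), fun a => by
    obtain ⟨b, rfl⟩ := hf a
    exact ⟨⟨b, trivial⟩, rfl⟩⟩

theorem divides_of_inj {A B : Type} [Mul A] [Mul B] (f : A →ₙ* B)
    (hf : Function.Injective f) : Divides A B := by
  have : ∀ w : f.srange, ∃ a, f a = w.1 := fun w => w.2
  choose g hg using this
  refine ⟨f.srange, ⟨g, fun a b => hf ?_⟩, fun a => ⟨⟨f a, a, rfl⟩, hf (hg _)⟩⟩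
  rw [map_mul, hg, hg, hg]
  rfl

/-! ### The decomposable class -/

/-- Allowed factors. -/
def Ok (S : Type) [Mul S] (M : MonCat.{0}) : Prop :=
  Nonempty (M ≃* FlipFlop) ∨
    ∃ (G : Type) (_ : Group G) (_ : Finite G),
      IsSimpleGroup G ∧ Divides G S ∧ Nonempty (M ≃* G)

/-- Decomposable transformation sets. -/
def KR (S : Type) [Mul S] {X : Type} (T : Set (X → X)) : Prop :=
  ∃ L : List MonCat.{0}, (∀ M ∈ L, Ok S M) ∧ Sim T (Tr L)

theorem KR.sim {S : Type} [Mul S] {X Y : Type} {T : Set (X → X)} {Q : Set (Y → Y)}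
    (h : KR S Q) (k : Sim T Q) : KR S T := by
  obtain ⟨L, hL, h⟩ := h
  exact ⟨L, hL, k.trans h⟩

theorem KR.up {S S' : Type} [Mul S] [Mul S'] {X : Type} {T : Set (X → X)}
    (h : KR S T) (k : Divides S S') : KR S' T := by
  obtain ⟨L, hL, h⟩ := h
  refine ⟨L, fun M hM => ?_, h⟩
  rcases hL M hM with h | ⟨G, i, j, a, b, c⟩
  · exact Or.inl h
  · exact Or.inr ⟨G, i, j, a, b.trans' k, c⟩

theorem KR.casc {S : Type} [Mul S] {X Y : Type} {T : Set (X → X)} {Q : Set (Y → Y)}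
    (h : KR S T) (k : KR S Q) : KR S (casc T Q) := by
  obtain ⟨L, hL, h⟩ := h
  obtain ⟨K, hK, k⟩ := k
  refine ⟨L ++ K, fun M hM => ?_, (Sim.casc h k).trans (Tr_append L K)⟩
  rcases List.mem_append.1 hM with h | h
  · exact hL M h
  · exact hK M h

theorem KR.single {S : Type} [Mul S] {M : Type} [Monoid M] (h : Ok S (MonCat.of M)) :
    KR S (rm M) := by
  refine ⟨[MonCat.of M], by simpa using h, fun z => z.1, fun m => ⟨(m, PUnit.unit), rfl⟩, ?_⟩
  rintro t ht
  exact ⟨_, ⟨fun _ => t, id, fun _ => ht, rfl, rfl⟩, fun _ => rfl⟩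

theorem KR.triv {S : Type} [Mul S] {X : Type} [Unique X] (T : Set (X → X)) : KR S T :=
  ⟨[], by simp, fun _ => default, fun x => ⟨PUnit.unit, Subsingleton.elim _ _⟩,
    fun _ _ => ⟨id, rfl, fun _ => Subsingleton.elim _ _⟩⟩

theorem KR_fin (S : Type) [Mul S] (n : ℕ) : KR S (stor (Fin (n + 1))) := by
  induction n with
  | zero => exact KR.triv (X := Fin 1) _
  | succ n ih =>
    have hU : KR S (rm FlipFlop) := KR.single (Or.inl ⟨MulEquiv.refl _⟩)
    refine (hU.casc ih).sim ?_
    refine ⟨fun z => if z.1 = FlipFlop.a then 0 else z.2.succ, fun i => ?_, ?_⟩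
    · refine Fin.cases ⟨(FlipFlop.a, 0), by simp⟩ (fun j => ⟨(FlipFlop.b, j), by simp⟩) i
    · rintro t (rfl | ⟨m, rfl⟩)
      · exact ⟨_, ⟨fun _ x => x * 1, id, fun _ => ⟨1, rfl⟩, Or.inl rfl, rfl⟩, fun y => by simp⟩
      · refine Fin.cases ?_ (fun j => ?_) m
        · exact ⟨_, ⟨fun _ x => x * FlipFlop.a, id, fun _ => ⟨_, rfl⟩, Or.inl rfl, rfl⟩,
            fun y => if_pos rfl⟩
        · refine ⟨_, ⟨fun _ x => x * FlipFlop.b, fun _ => j, fun _ => ⟨_, rfl⟩,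
            Or.inr ⟨j, rfl⟩, rfl⟩, fun y => if_neg ?_⟩
          show FlipFlop.b ≠ FlipFlop.a
          decide

theorem KR_stor (S : Type) [Mul S] (X : Type) [Finite X] [Nonempty X] : KR S (stor X) := by
  obtain ⟨n, ⟨e⟩⟩ := Finite.exists_equiv_fin X
  cases n with
  | zero => exact (e (Classical.arbitrary X)).elim0
  | succ n => exact (KR_fin S n).sim (stor_sim e.symm e.symm.surjective)

/-! ### Groups -/

theorem KR_group (n : ℕ) : ∀ (G : Type) [Group G] [Finite G], Nat.card G = n → KR G (rm G) := by
  induction n using Nat.strong_induction_on with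
  | _ n ih =>
    intro G _ _ hn
    rcases subsingleton_or_nontrivial G with hs | hs
    · have : Unique G := uniqueOfSubsingleton 1
      exact KR.triv _
    by_cases hG : IsSimpleGroup G
    · exact KR.single (Or.inr ⟨G, inferInstance, inferInstance, hG,
        divides_of_inj (MulHom.id G) Function.injective_id, ⟨MulEquiv.refl _⟩⟩)
    · have : ∃ N : Subgroup G, N.Normal ∧ N ≠ ⊥ ∧ N ≠ ⊤ := by
        by_contra hc
        push Not at hc
        exact hG ⟨fun N hN => by
          by_cases h : N = ⊥
          · exact Or.inl h
          · exact Or.inr (hc N hN h)⟩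
      obtain ⟨N, hN, hb, ht⟩ := this
      have hcard := N.card_eq_card_quotient_mul_card_subgroup
      have h1 : 1 < Nat.card N := Subgroup.one_lt_card_iff_ne_bot N |>.2 hb
      have h2 : Nat.card N < Nat.card G := by
        rcases lt_or_eq_of_le (Nat.card_le_card_of_injective _ N.subtype_injective) with h | h
        · exact h
        · exact absurd (N.eq_top_of_card_eq h) ht
      have h0 : 0 < Nat.card (G ⧸ N) := Nat.card_pos
      have h3 : Nat.card (G ⧸ N) < Nat.card G := by nlinarith
      have k1 : KR G (rm N) := (ih _ (hn ▸ h2) N rfl).up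
        (divides_of_inj (N.subtype : N →ₙ* G) N.subtype_injective)
      have k2 : KR G (rm (G ⧸ N)) := (ih _ (hn ▸ h3) (G ⧸ N) rfl).up
        (divides_of_surj (QuotientGroup.mk' N : G →ₙ* G ⧸ N) (QuotientGroup.mk'_surjective N))
      refine (k1.casc k2).sim ?_
      have hout : ∀ q : G ⧸ N, ((Quotient.out q : G) : G ⧸ N) = q := fun q => Quotient.out_eq q
      have hmem : ∀ x y : G, (x : G ⧸ N) = y → x * y⁻¹ ∈ N := by
        intro x y h
        rw [← QuotientGroup.eq_one_iff, QuotientGroup.mk_mul, h, ← QuotientGroup.mk_mul]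
        simp
      refine ⟨fun z => z.1.1 * Quotient.out z.2, fun x => ?_, ?_⟩
      · exact ⟨(⟨x * (Quotient.out (x : G ⧸ N))⁻¹, hmem _ _ (hout _).symm⟩, (x : G ⧸ N)), by simp⟩
      · rintro _ ⟨g, rfl⟩
        let k : G ⧸ N → N := fun q => ⟨Quotient.out q * g *
          (Quotient.out (q * (g : G ⧸ N)))⁻¹, hmem _ _ (by rw [hout, QuotientGroup.mk_mul, hout])⟩
        refine ⟨_, ⟨fun q x => x * k q, fun q => q * (g : G ⧸ N),
          fun q => ⟨_, rfl⟩, ⟨_, rfl⟩, rfl⟩, ?_⟩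
        · rintro ⟨x, q⟩
          simp [k, mul_assoc]

theorem KR_group' (G : Type) [Group G] [Finite G] : KR G (rmc G) := by
  refine ((KR_stor G G).casc (KR_group _ G rfl)).sim ?_
  refine ⟨fun z => z.1 * z.2, fun x => ⟨(x, 1), by simp⟩, ?_⟩
  rintro _ (⟨g, rfl⟩ | ⟨g, rfl⟩)
  · exact ⟨_, ⟨fun _ => id, fun x => x * g, fun _ => Or.inl rfl, ⟨g, rfl⟩, rfl⟩,
      fun y => by simp [mul_assoc]⟩
  · exact ⟨_, ⟨fun h _ => g * h⁻¹, fun x => x * 1, fun h => Or.inr ⟨_, rfl⟩, ⟨1, rfl⟩, rfl⟩,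
      fun y => by simp⟩

/-! ### Local divisors -/

/-- The local divisor `cM ∩ Mc`. -/
def LocDiv {M : Type} [Monoid M] (c : M) : Type := {x : M // (∃ y, x = c * y) ∧ ∃ z, x = z * c}

namespace LocDiv

variable {M : Type} [Monoid M] {c : M}

/-- A right cofactor. -/
noncomputable def w (x : LocDiv c) : M := x.2.1.choose

theorem w_spec (x : LocDiv c) : x.1 = c * w x := x.2.1.choose_spec

theorem mul_cof (x : LocDiv c) {u v : M} (h : c * u = c * v) : x.1 * u = x.1 * v := by
  obtain ⟨z, hz⟩ := x.2.2
  rw [hz, mul_assoc, mul_assoc, h]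

theorem mul_aux (x y : LocDiv c) :
    (∃ u, x.1 * w y = c * u) ∧ ∃ z, x.1 * w y = z * c := by
  constructor
  · exact ⟨w x * w y, by rw [w_spec x, mul_assoc]⟩
  · obtain ⟨z, hz⟩ := x.2.2
    obtain ⟨z', hz'⟩ := y.2.2
    exact ⟨z * z', by rw [hz, mul_assoc, ← w_spec, hz', mul_assoc]⟩

noncomputable instance : Mul (LocDiv c) := ⟨fun x y => ⟨x.1 * w y, mul_aux x y⟩⟩

theorem mul_val (x y : LocDiv c) : (x * y).1 = x.1 * w y := rfl

noncomputable instance : One (LocDiv c) := ⟨⟨c, ⟨1, by simp⟩, 1, by simp⟩⟩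

theorem one_val : (1 : LocDiv c).1 = c := rfl

theorem mul_val' (x y : LocDiv c) (u : M) (h : y.1 = c * u) : (x * y).1 = x.1 * u := by
  rw [mul_val]
  exact mul_cof x (by rw [← w_spec, h])

noncomputable instance : Monoid (LocDiv c) where
  mul_assoc x y z := by
    apply Subtype.ext
    rw [mul_val, mul_val, mul_val' x (y * z) (w y * w z), mul_assoc]
    rw [mul_val, w_spec y, mul_assoc]
  one_mul x := by
    apply Subtype.ext
    rw [mul_val, one_val, ← w_spec]
  mul_one x := by
    apply Subtype.ext
    rw [mul_val' x 1 1, mul_one]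
    rw [one_val, mul_one]

instance [Finite M] : Finite (LocDiv c) := by
  unfold LocDiv
  infer_instance

theorem divides : Divides (LocDiv c) M := by
  let V : Subsemigroup M :=
    { carrier := {m | ∃ z, c * m = z * c}
      mul_mem' := by
        rintro a b ⟨z, hz⟩ ⟨z', hz'⟩
        exact ⟨z * z', by rw [← mul_assoc, hz, mul_assoc, hz', mul_assoc]⟩ }
  let F : V → LocDiv c := fun m => ⟨c * m.1, ⟨m.1, rfl⟩, m.2⟩
  refine ⟨V, ⟨F, ?_⟩, ?_⟩
  · intro a b
    apply Subtype.ext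
    exact ((mul_val' (F a) (F b) b.1 rfl).trans (mul_assoc c a.1 b.1)).symm
  · intro x
    exact ⟨⟨w x, by obtain ⟨z, hz⟩ := x.2.2; exact ⟨z, by rw [← w_spec, hz]⟩⟩,
      Subtype.ext (w_spec x).symm⟩

theorem card_lt [Finite M] (hc : ¬ IsUnit c) : Nat.card (LocDiv c) < Nat.card M := by
  refine Finite.card_subtype_lt (x := (1 : M)) ?_
  rintro ⟨⟨y, hy⟩, z, hz⟩
  apply hc
  have : z = y := by
    calc z = z * (c * y) := by rw [← hy, mul_one]
      _ = y := by rw [← mul_assoc, ← hz, one_mul]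
  subst this
  exact ⟨⟨c, z, hy.symm, hz.symm⟩, rfl⟩

end LocDiv

/-! ### The induction step -/

theorem step_sim {M : Type} [Monoid M] (N : Submonoid M) (c : M)
    (hgen : N ⊔ Submonoid.closure {c} = ⊤) :
    Sim (rmc M) (casc (rmc (LocDiv c)) (casc (stor N) (casc (stor Bool) (rmc N)))) := by
  classical
  set Q := casc (rmc (LocDiv c)) (casc (stor N) (casc (stor Bool) (rmc N))) with hQ
  have hcl : IsCl Q :=
    casc_cl (rmc_cl _) (casc_cl (stor_cl _) (casc_cl (stor_cl _) (rmc_cl _)))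
  have hcst : cst _ ⊆ Q :=
    casc_cst Set.subset_union_right (casc_cst Set.subset_union_right
      (casc_cst Set.subset_union_right Set.subset_union_right))
  let p : LocDiv c × N × Bool × N → M := fun s =>
    if s.2.2.1 = true then s.2.1.1 * s.1.1 * s.2.2.2.1 else s.2.2.2.1
  let K : Submonoid M :=
    { carrier := {m | ∃ q ∈ Q, ∀ s, p (q s) = p s * m}
      one_mem' := ⟨id, hcl.1, fun s => by simp⟩
      mul_mem' := by
        rintro a b ⟨q, hq, e⟩ ⟨q', hq', e'⟩
        exact ⟨q' ∘ q, hcl.2 _ hq _ hq', fun s => by simp [e, e', mul_assoc]⟩ }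
  have hK : ∀ m, m ∈ K := by
    have hN : N ≤ K := by
      intro n hn
      refine ⟨_, ⟨fun _ => id, _, fun _ => (rmc_cl _).1,
        ⟨fun _ => id, _, fun _ => Or.inl rfl, ⟨fun _ => id, fun x => x * ⟨n, hn⟩,
          fun _ => Or.inl rfl, Or.inl ⟨_, rfl⟩, rfl⟩, rfl⟩, rfl⟩, ?_⟩
      rintro ⟨m, u, f, x⟩
      cases f <;> simp [p, mul_assoc]
    have hc : Submonoid.closure {c} ≤ K := by
      rw [Submonoid.closure_le, Set.singleton_subset_iff]
      let y : N → LocDiv c := fun n =>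
        ⟨c * n.1 * c, ⟨n.1 * c, by rw [mul_assoc]⟩, c * n.1, rfl⟩
      refine ⟨_, ⟨fun s => if s.2.1 = true then (fun m => m * y s.2.2) else fun _ => 1, _,
        fun s => ?_,
        ⟨fun s => if s.1 = true then id else fun _ => s.2, _, fun s => ?_,
          ⟨fun _ _ => true, fun _ => 1,
          fun _ => Or.inr ⟨_, rfl⟩, Or.inr ⟨_, rfl⟩, rfl⟩, rfl⟩, rfl⟩, ?_⟩
      · dsimp only
        split_ifs
        · exact Or.inl ⟨_, rfl⟩
        · exact Or.inr ⟨_, rfl⟩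
      · dsimp only
        split_ifs
        · exact Or.inl rfl
        · exact Or.inr ⟨_, rfl⟩
      · rintro ⟨m, u, f, x⟩
        cases f
        · simp [p, LocDiv.one_val]
        · have : (m * y x).1 = m.1 * (x.1 * c) := LocDiv.mul_val' _ _ _ (mul_assoc _ _ _)
          simp [p, this, mul_assoc]
    intro m
    have : (⊤ : Submonoid M) ≤ K := hgen ▸ sup_le hN hc
    exact this trivial
  have hsurj : Function.Surjective p := by
    intro m
    obtain ⟨q, -, e⟩ := hK m
    exact ⟨q (1, 1, false, 1), by rw [e]; simp [p]⟩
  refine ⟨p, hsurj, ?_⟩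
  rintro _ (⟨m, rfl⟩ | ⟨m, rfl⟩)
  · exact hK m
  · obtain ⟨s, rfl⟩ := hsurj m
    exact ⟨_, hcst ⟨s, rfl⟩, fun _ => rfl⟩

theorem KR_monoid (n : ℕ) :
    ∀ (M : Type) [Monoid M] [Finite M], Nat.card M = n → KR M (rmc M) := by
  induction n using Nat.strong_induction_on with
  | _ n ih =>
    intro M _ _ hn
    by_cases hu : ∀ x : M, IsUnit x
    · let : Group M := groupOfIsUnit hu
      exact KR_group' M
    · push Not at hu
      obtain ⟨x, hx⟩ := hu
      obtain h | ⟨N, hN, hle⟩ := eq_top_or_exists_le_coatom (IsUnit.submonoid M)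
      · have : x ∈ IsUnit.submonoid M := h ▸ trivial
        exact absurd this hx
      have : ∃ c, c ∉ N := by
        by_contra hc
        push Not at hc
        exact hN.1 (eq_top_iff.2 fun z _ => hc z)
      obtain ⟨c, hc⟩ := this
      have hcu : ¬ IsUnit c := fun h => hc (hle h)
      have hgen : N ⊔ Submonoid.closure {c} = ⊤ := by
        apply hN.2
        refine lt_of_le_of_ne le_sup_left fun h => hc ?_
        rw [h]
        exact (le_sup_right : _ ≤ N ⊔ Submonoid.closure {c}) (Submonoid.subset_closure rfl)
      have k1 : KR M (rmc (LocDiv c)) :=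
        (ih _ (hn ▸ LocDiv.card_lt hcu) _ rfl).up LocDiv.divides
      have k2 : KR M (rmc N) :=
        (ih _ (hn ▸ Finite.card_subtype_lt hc) N rfl).up
          (divides_of_inj (N.subtype : N →ₙ* M) Subtype.val_injective)
      exact (k1.casc ((KR_stor M N).casc ((KR_stor M Bool).casc k2))).sim (step_sim N c hgen)

theorem divides_withOne {S G : Type} [Semigroup S] [Group G] [Nontrivial G]
    (h : Divides G (WithOne S)) : Divides G S := by
  obtain ⟨V, f, hf⟩ := h
  let e : S →ₙ* WithOne S := WithOne.coeMulHom
  have hne : ∀ g : G, g ≠ 1 → ∃ (s : S) (hs : e s ∈ V), f ⟨e s, hs⟩ = g := by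
    intro g hg
    obtain ⟨⟨v, hv⟩, rfl⟩ := hf g
    cases v using WithOne.recOneCoe with
    | one =>
      exfalso
      apply hg
      have : f ⟨1, hv⟩ * f ⟨1, hv⟩ = f ⟨1, hv⟩ := by
        rw [← map_mul]
        congr 1
      exact mul_eq_left.1 this
    | coe s => exact ⟨s, hv, rfl⟩
  refine ⟨V.comap e, ⟨fun s => f ⟨e s.1, s.2⟩, ?_⟩, ?_⟩
  · intro a b
    rw [← map_mul]
    congr 1
  · intro g
    by_cases hg : g = 1
    · obtain ⟨x, hx⟩ := exists_ne (1 : G)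
      obtain ⟨s, hs, e1⟩ := hne x hx
      obtain ⟨t, ht, e2⟩ := hne x⁻¹ (inv_ne_one.2 hx)
      refine ⟨⟨s, hs⟩ * ⟨t, ht⟩, ?_⟩
      have : f (⟨e s, hs⟩ * ⟨e t, ht⟩) = g := by rw [map_mul, e1, e2, hg, mul_inv_cancel]
      exact this
    · obtain ⟨s, hs, e1⟩ := hne g hg
      exact ⟨⟨s, hs⟩, e1⟩

/-- **Krohn–Rhodes prime decomposition theorem.** Every finite semigroup `S` divides
an iterated wreath product `X₁ ≀ (X₂ ≀ (⋯ ≀ Xₙ))` in which every factor `Xᵢ` is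
either the three-element flip-flop monoid or a finite simple group dividing `S`. -/
theorem krohn_rhodes (S : Type) [Semigroup S] [Finite S] :
    ∃ Ms : List MonCat,
      (∀ M ∈ Ms, Nonempty (M ≃* FlipFlop) ∨
        ∃ (G : Type) (_ : Group G) (_ : Finite G),
          IsSimpleGroup G ∧ Divides G S ∧ Nonempty (M ≃* G)) ∧
      Divides S (iterWreath Ms) := by
  have : Finite (WithOne S) := inferInstanceAs (Finite (Option S))
  obtain ⟨L, hL, h⟩ := KR_monoid _ (WithOne S) rfl
  refine ⟨L, fun M hM => ?_, ?_⟩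
  · rcases hL M hM with h | ⟨G, i, j, a, b, c⟩
    · exact Or.inl h
    · have := a.toNontrivial
      exact Or.inr ⟨G, i, j, a, divides_withOne b, c⟩
  · have h1 : Sim (rm (WithOne S)) (rm (iterWreath L)) :=
      ((Sim.mono Set.subset_union_left).trans h).trans (Tr_wreath L)
    exact (divides_of_inj (WithOne.coeMulHom : S →ₙ* WithOne S) WithOne.coe_injective).trans'
      h1.divides
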